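/- arXiv:2403.18382 — 4 statements merged into one kernel-verified Lean document; each statement's English description precedes it below -/
import Mathlib

section
/- If ℓ and n are coprime odd positive integers, then for every integer m one has G_m(ℓn) = G_m(ℓ)·G_m(n). -/
open scoped BigOperators

/-- `e x = exp(2πix)`. -/
noncomputable def e (x : ℝ) : ℂ := Complex.exp (2 * Real.pi * Complex.I * x)

/-- The Gauss sum `τ_m(n) = Σ_{b mod n} (b/n) e(mb/n)`, where `(·/n)` is the Jacobi symbol. -/
noncomputable def tauGauss (m : ℤ) (n : ℕ) : ℂ :=
  ∑ b ∈ Finset.range n, (jacobiSym (b : ℤ) n : ℂ) * e ((m : ℝ) * (b : ℝ) / (n : ℝ))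

/-- `G_m(n) = ((1−i)/2 + (−1/n)(1+i)/2) τ_m(n)`. -/
noncomputable def GGauss (m : ℤ) (n : ℕ) : ℂ :=
  ((1 - Complex.I) / 2 + (jacobiSym (-1) n : ℂ) * (1 + Complex.I) / 2) * tauGauss m n

theorem e_add (x y : ℝ) : e (x + y) = e x * e y := by
  simp only [e, ← Complex.exp_add]
  push_cast
  ring_nf

theorem e_intCast (k : ℤ) : e (k : ℝ) = 1 := by
  rw [e, Complex.exp_eq_one_iff]
  exact ⟨k, by push_cast; ring⟩

/-- The summand of `tauGauss m N` is periodic modulo `N`. -/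
theorem tauGauss_summand_mod (m : ℤ) {N : ℕ} (hN : 0 < N) (b : ℕ) :
    (jacobiSym ((b % N : ℕ) : ℤ) N : ℂ) * e ((m : ℝ) * ((b % N : ℕ) : ℝ) / (N : ℝ)) =
      (jacobiSym (b : ℤ) N : ℂ) * e ((m : ℝ) * (b : ℝ) / (N : ℝ)) := by
  have hN' : (N : ℝ) ≠ 0 := by positivity
  have hb : (b : ℝ) = ((b % N : ℕ) : ℝ) + (N : ℝ) * ((b / N : ℕ) : ℝ) := by
    exact_mod_cast (Nat.mod_add_div b N).symm
  have hsplit : (m : ℝ) * (b : ℝ) / (N : ℝ) =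
      (m : ℝ) * ((b % N : ℕ) : ℝ) / (N : ℝ) + ((m * (b / N : ℕ) : ℤ) : ℝ) := by
    rw [hb, Int.cast_mul, Int.cast_natCast]
    field_simp
  rw [hsplit, e_add, e_intCast, mul_one, jacobiSym.mod_left (b : ℤ) N, Int.natCast_mod]

theorem sum_range_mul_of_coprime {M : Type*} [AddCommMonoid M] (f : ℕ → M) {ℓ n : ℕ}
    (hcop : Nat.Coprime ℓ n) (hℓ : 0 < ℓ) (hn : 0 < n) :
    ∑ b ∈ Finset.range (ℓ * n), f b =
      ∑ p ∈ Finset.range ℓ ×ˢ Finset.range n, f ((p.1 * n + p.2 * ℓ) % (ℓ * n)) := by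
  have hmaps : Set.MapsTo (fun p : ℕ × ℕ => (p.1 * n + p.2 * ℓ) % (ℓ * n))
      (Finset.range ℓ ×ˢ Finset.range n : Finset (ℕ × ℕ)) (Finset.range (ℓ * n)) := by
    intro p _
    simpa using Nat.mod_lt _ (Nat.mul_pos hℓ hn)
  have hinj : Set.InjOn (fun p : ℕ × ℕ => (p.1 * n + p.2 * ℓ) % (ℓ * n))
      (Finset.range ℓ ×ˢ Finset.range n : Finset (ℕ × ℕ)) := by
    rintro ⟨x, y⟩ hp ⟨x', y'⟩ hq h
    simp only [Finset.coe_product, Finset.coe_range, Set.mem_prod, Set.mem_Iio] at hp hq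
    have h' : x * n + y * ℓ ≡ x' * n + y' * ℓ [MOD ℓ * n] := h
    have hx : x * n ≡ x' * n [MOD ℓ] := by
      simpa [Nat.ModEq] using h'.of_mul_right n
    have hy : y * ℓ ≡ y' * ℓ [MOD n] := by
      simpa [Nat.ModEq] using h'.of_mul_left ℓ
    have hx' := (Nat.ModEq.cancel_right_of_coprime hcop hx).eq_of_lt_of_lt hp.1 hq.1
    have hy' := (Nat.ModEq.cancel_right_of_coprime hcop.symm hy).eq_of_lt_of_lt hp.2 hq.2
    rw [hx', hy']
  exact (Finset.sum_nbij _ hmaps hinj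
    (Finset.surjOn_of_injOn_of_card_le _ hmaps hinj (by simp)) fun _ _ => rfl).symm

theorem tauGauss_mul (m : ℤ) {ℓ n : ℕ} (hℓ : 0 < ℓ) (hn : 0 < n) (hcop : Nat.Coprime ℓ n) :
    tauGauss m (ℓ * n) =
      ((jacobiSym n ℓ * jacobiSym ℓ n : ℤ) : ℂ) * (tauGauss m ℓ * tauGauss m n) := by
  have hℓ' : (ℓ : ℝ) ≠ 0 := by positivity
  have hn' : (n : ℝ) ≠ 0 := by positivity
  unfold tauGauss
  rw [sum_range_mul_of_coprime _ hcop hℓ hn, Finset.sum_mul_sum, ← Finset.sum_product',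
    Finset.mul_sum]
  refine Finset.sum_congr rfl fun p _ => ?_
  rw [tauGauss_summand_mod m (Nat.mul_pos hℓ hn), jacobiSym.mul_right' _ hℓ.ne' hn.ne']
  have hJℓ : jacobiSym ((p.1 * n + p.2 * ℓ : ℕ) : ℤ) ℓ = jacobiSym p.1 ℓ * jacobiSym n ℓ := by
    rw [← jacobiSym.mul_left]
    exact jacobiSym.mod_left' (by simp)
  have hJn : jacobiSym ((p.1 * n + p.2 * ℓ : ℕ) : ℤ) n = jacobiSym p.2 n * jacobiSym ℓ n := by
    rw [← jacobiSym.mul_left]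
    exact jacobiSym.mod_left' (by simp)
  have harg : (m : ℝ) * ((p.1 * n + p.2 * ℓ : ℕ) : ℝ) / ((ℓ * n : ℕ) : ℝ) =
      (m : ℝ) * (p.1 : ℝ) / (ℓ : ℝ) + (m : ℝ) * (p.2 : ℝ) / (n : ℝ) := by
    push_cast
    field_simp
  rw [hJℓ, hJn, harg, e_add]
  push_cast
  ring

/-- Quadratic reciprocity, as a product formula for the normalizing factor of `GGauss`. -/
theorem normalizing_factor_mul {ℓ n : ℕ} (hℓodd : Odd ℓ) (hnodd : Odd n)
    (hcop : Nat.Coprime ℓ n) :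
    ((1 - Complex.I) / 2 + (jacobiSym (-1) (ℓ * n) : ℂ) * (1 + Complex.I) / 2) *
        ((jacobiSym n ℓ * jacobiSym ℓ n : ℤ) : ℂ) =
      ((1 - Complex.I) / 2 + (jacobiSym (-1) ℓ : ℂ) * (1 + Complex.I) / 2) *
        ((1 - Complex.I) / 2 + (jacobiSym (-1) n : ℂ) * (1 + Complex.I) / 2) := by
  have hI := Complex.I_mul_I
  have hsq : jacobiSym n ℓ * jacobiSym n ℓ = 1 := by
    rw [← sq]
    exact jacobiSym.sq_one (by simpa using hcop.symm)
  rw [jacobiSym.mul_right' _ hℓodd.pos.ne' hnodd.pos.ne', jacobiSym.at_neg_one hℓodd,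
    jacobiSym.at_neg_one hnodd]
  rcases Nat.odd_mod_four_iff.mp (Nat.odd_iff.mp hℓodd) with h1 | h3
  · rw [jacobiSym.quadratic_reciprocity_one_mod_four h1 hnodd, hsq,
      ZMod.χ₄_nat_one_mod_four h1]
    push_cast
    ring
  · rcases Nat.odd_mod_four_iff.mp (Nat.odd_iff.mp hnodd) with k1 | k3
    · rw [jacobiSym.quadratic_reciprocity_one_mod_four' hℓodd k1, hsq,
        ZMod.χ₄_nat_one_mod_four k1]
      push_cast
      ring
    · rw [jacobiSym.quadratic_reciprocity_three_mod_four h3 k3, mul_neg, hsq,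
        ZMod.χ₄_nat_three_mod_four h3, ZMod.χ₄_nat_three_mod_four k3]
      push_cast
      linear_combination -hI

/-- If `ℓ` and `n` are coprime odd positive integers, then `G_m(ℓn) = G_m(ℓ)·G_m(n)`. -/
theorem GGauss_mul (m : ℤ) (ℓ n : ℕ) (hℓ : 0 < ℓ) (hn : 0 < n)
    (hℓodd : Odd ℓ) (hnodd : Odd n) (hcop : Nat.Coprime ℓ n) :
    GGauss m (ℓ * n) = GGauss m ℓ * GGauss m n := by
  unfold GGauss
  rw [tauGauss_mul m hℓ hn hcop, ← mul_assoc, normalizing_factor_mul hℓodd hnodd hcop]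
  ring
end

section
/- Let N0 be a positive integer, let v be a squarefree positive integer, and let d be a positive integer with v ∣ d and gcd(d, N0) = 1. Then Σ_{β ∣ gcd(v, d/v)} μ(β) · Σ_{α ≥ 1, gcd(α, v·N0) = 1, α² ∣ d/v} μ(α) equals 1 if d is squarefree and equals 0 otherwise, where μ denotes the Möbius function. -/
open scoped BigOperators

theorem Nat.sq_dvd_sq_mul_squarefree_iff {a b c : ℕ} (ha : Squarefree a) (hb : b ≠ 0) :
    c ^ 2 ∣ b ^ 2 * a ↔ c ∣ b := by
  refine ⟨fun h => ?_, fun h => (pow_dvd_pow_of_dvd h 2).mul_right a⟩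
  have hba : b ^ 2 * a ≠ 0 := mul_ne_zero (pow_ne_zero 2 hb) ha.ne_zero
  have hc : c ≠ 0 := by
    rintro rfl
    exact hba (by simpa using h)
  rw [← Nat.factorization_le_iff_dvd hc hb]
  intro p
  have hp := (Nat.factorization_le_iff_dvd (pow_ne_zero 2 hc) hba).2 h p
  rw [Nat.factorization_mul (pow_ne_zero 2 hb) ha.ne_zero] at hp
  simp only [Nat.factorization_pow, Finsupp.add_apply, Finsupp.smul_apply, smul_eq_mul] at hp
  have := ha.natFactorization_le_one p
  omega

theorem ArithmeticFunction.sum_divisors_moebius (n : ℕ) :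
    ∑ i ∈ n.divisors, moebius i = if n = 1 then 1 else 0 := by
  rw [← coe_mul_zeta_apply, moebius_mul_coe_zeta, one_apply]

theorem ArithmeticFunction.sum_moebius_sq_dvd {n : ℕ} (hn : n ≠ 0) :
    (∑ i ∈ n.divisors, if i ^ 2 ∣ n then moebius i else 0) =
      if Squarefree n then 1 else 0 := by
  obtain ⟨a, b, hab, ha⟩ := Nat.sq_mul_squarefree n
  have hb : b ≠ 0 := by
    rintro rfl
    exact hn (by simpa using hab.symm)
  have hfilter : n.divisors.filter (fun i => i ^ 2 ∣ n) = b.divisors := by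
    ext i
    simp only [Finset.mem_filter, Nat.mem_divisors, ← hab, Nat.sq_dvd_sq_mul_squarefree_iff ha hb]
    refine ⟨fun h => ⟨h.2, hb⟩, fun h => ⟨⟨?_, hab ▸ hn⟩, h.1⟩⟩
    exact (h.1.trans (dvd_pow_self b two_ne_zero)).mul_right a
  have hsq : Squarefree n ↔ b = 1 := by
    refine ⟨fun h => Nat.isUnit_iff.1 (h b ⟨a, by rw [← hab, sq]⟩), ?_⟩
    rintro rfl
    simpa [← hab] using ha
  rw [← Finset.sum_filter, hfilter, sum_divisors_moebius]
  simp only [hsq]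

open ArithmeticFunction in
/-- For squarefree `v ∣ d` with `gcd(d, N0) = 1`,
`Σ_{β ∣ gcd(v, d/v)} μ(β) Σ_{α ≥ 1, (α, vN0)=1, α² ∣ d/v} μ(α)` detects squarefree `d`. -/
theorem moebius_sieve_squarefree (N0 : ℕ) (hN0 : 0 < N0) (v : ℕ) (hv : Squarefree v)
    (d : ℕ) (hd : 0 < d) (hvd : v ∣ d) (hcop : Nat.Coprime d N0) :
    (∑ β ∈ (Nat.gcd v (d / v)).divisors, (moebius β) *
        ∑ α ∈ (d / v).divisors,
          if Nat.Coprime α (v * N0) ∧ α ^ 2 ∣ d / v then moebius α else 0) =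
      if Squarefree d then 1 else 0 := by
  obtain ⟨e, rfl⟩ := hvd
  have hv0 : 0 < v := Nat.pos_of_mul_pos_right hd
  have he0 : e ≠ 0 := by
    rintro rfl
    simp at hd
  rw [Nat.mul_div_cancel_left e hv0, ← Finset.sum_mul, sum_divisors_moebius]
  by_cases hve : Nat.Coprime v e
  · rw [if_pos hve, one_mul]
    simp only [Nat.squarefree_mul hve, hv, true_and]
    rw [← sum_moebius_sq_dvd he0]
    refine Finset.sum_congr rfl fun α hα => ?_
    have hαe := Nat.dvd_of_mem_divisors hα
    have hαc : Nat.Coprime α (v * N0) :=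
      Nat.Coprime.mul_right (hve.symm.coprime_dvd_left hαe)
        (hcop.coprime_dvd_left (hαe.mul_left v))
    exact if_congr (and_iff_right hαc) rfl rfl
  · rw [if_neg hve, zero_mul, if_neg fun h => hve (Nat.coprime_of_squarefree_mul h)]
end

section
/- The function G is multiplicative: G(1) = 1, and G(m·n) = G(m)·G(n) for all coprime positive integers m and n. -/
open scoped BigOperators

/-- `c(p) = 1 + #{z mod p : F(z) ≡ 0 (mod p)}`. -/
def cF (F : Polynomial ℤ) (p : ℕ) : ℕ :=
  1 + ((Finset.range p).filter (fun z : ℕ => (p : ℤ) ∣ F.eval (z : ℤ))).card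

/-- `C_p(s) = (p/(p+1))·log c(p)` if `p ∣ s`, and `−(1/(p+1))·log c(p)` otherwise. -/
noncomputable def CpF (F : Polynomial ℤ) (p s : ℕ) : ℝ :=
  if p ∣ s then ((p : ℝ) / ((p : ℝ) + 1)) * Real.log (cF F p)
  else -(1 / ((p : ℝ) + 1)) * Real.log (cF F p)

/-- For `n = q_1^{m_1} ⋯ q_u^{m_u}`,
`G(n) = Σ_{v ∣ q_1⋯q_u} Σ_{rs = v} μ(r) (Π_i C_{q_i}(s)^{m_i}) Π_{p ∣ v} 1/(p+1)`. -/
noncomputable def GF (F : Polynomial ℤ) (n : ℕ) : ℝ :=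
  ∑ v ∈ (∏ p ∈ n.primeFactors, p).divisors, ∑ r ∈ v.divisors,
    (ArithmeticFunction.moebius r : ℝ) *
      (∏ p ∈ n.primeFactors, (CpF F p (v / r)) ^ (n.factorization p)) *
      ∏ p ∈ v.primeFactors, (1 : ℝ) / ((p : ℝ) + 1)

/-- A sum over the divisors of a product of coprime numbers splits as a product of sums if the
summand does. -/
theorem Nat.Coprime.sum_divisors_mul_of_forall {R : Type*} [CommSemiring R] {a b : ℕ}
    (hab : a.Coprime b) (f g h : ℕ → R)
    (hf : ∀ x ∈ a.divisors, ∀ y ∈ b.divisors, f (x * y) = g x * h y) :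
    ∑ v ∈ (a * b).divisors, f v = (∑ x ∈ a.divisors, g x) * ∑ y ∈ b.divisors, h y := by
  rw [Nat.divisors_mul, Finset.mul_def, Finset.sum_image, Finset.sum_mul_sum, Finset.sum_product]
  · exact Finset.sum_congr rfl fun x hx => Finset.sum_congr rfl fun y hy => hf x hx y hy
  · exact hab.mul_injOn_divisors

theorem Nat.Coprime.prod_primeFactors_id {m n : ℕ} (h : m.Coprime n) :
    (∏ p ∈ m.primeFactors, p).Coprime (∏ p ∈ n.primeFactors, p) :=
  (h.coprime_dvd_left (Nat.prod_primeFactors_dvd m)).coprime_dvd_right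
    (Nat.prod_primeFactors_dvd n)

theorem CpF_mul_right (F : Polynomial ℤ) {p s t : ℕ} (h : p.Coprime t) :
    CpF F p (s * t) = CpF F p s := by
  simp only [CpF, h.dvd_mul_right]

/-- In the product over the prime factors of `m * n`, the factors at primes of `m` only see `s`
and the factors at primes of `n` only see `t`. -/
theorem prod_CpF_mul (F : Polynomial ℤ) {m n s t : ℕ} (hmn : m.Coprime n) (hs : s ∣ m)
    (ht : t ∣ n) :
    ∏ p ∈ (m * n).primeFactors, CpF F p (s * t) ^ (m * n).factorization p =
      (∏ p ∈ m.primeFactors, CpF F p s ^ m.factorization p) *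
        ∏ p ∈ n.primeFactors, CpF F p t ^ n.factorization p := by
  rw [hmn.primeFactors_mul, Finset.prod_union hmn.disjoint_primeFactors]
  congr 1
  · refine Finset.prod_congr rfl fun p hp => ?_
    rw [CpF_mul_right F ((hmn.coprime_dvd_left (Nat.dvd_of_mem_primeFactors hp)).coprime_dvd_right
      ht), Nat.factorization_eq_of_coprime_left hmn
        (Nat.mem_primeFactors_iff_mem_primeFactorsList.1 hp)]
  · refine Finset.prod_congr rfl fun p hp => ?_
    rw [mul_comm s t, CpF_mul_right F
      ((hmn.symm.coprime_dvd_left (Nat.dvd_of_mem_primeFactors hp)).coprime_dvd_right hs),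
      Nat.factorization_eq_of_coprime_right hmn
        (Nat.mem_primeFactors_iff_mem_primeFactorsList.1 hp)]

/-- `G` is multiplicative: `G(1) = 1` and `G(mn) = G(m)G(n)` for coprime `m, n`. -/
theorem GF_multiplicative (F : Polynomial ℤ) (hF : F.Monic) (hdeg : F.natDegree = 3) :
    GF F 1 = 1 ∧
    ∀ m n : ℕ, 0 < m → 0 < n → Nat.Coprime m n → GF F (m * n) = GF F m * GF F n := by
  refine ⟨by simp [GF], fun m n _ _ hmn => ?_⟩
  simp only [GF]
  rw [show ∏ p ∈ (m * n).primeFactors, p =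
      (∏ p ∈ m.primeFactors, p) * ∏ p ∈ n.primeFactors, p by
    rw [hmn.primeFactors_mul, Finset.prod_union hmn.disjoint_primeFactors]]
  refine hmn.prod_primeFactors_id.sum_divisors_mul_of_forall _ _ _ fun v hv w hw => ?_
  have hvm : v ∣ m := (Nat.dvd_of_mem_divisors hv).trans (Nat.prod_primeFactors_dvd m)
  have hwn : w ∣ n := (Nat.dvd_of_mem_divisors hw).trans (Nat.prod_primeFactors_dvd n)
  have hvw : v.Coprime w := (hmn.coprime_dvd_left hvm).coprime_dvd_right hwn
  refine hvw.sum_divisors_mul_of_forall _ _ _ fun r hr t ht => ?_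
  have hrv := Nat.dvd_of_mem_divisors hr
  have htw := Nat.dvd_of_mem_divisors ht
  rw [← Nat.div_mul_div_comm hrv htw,
    prod_CpF_mul F hmn ((Nat.div_dvd_of_dvd hrv).trans hvm) ((Nat.div_dvd_of_dvd htw).trans hwn),
    ArithmeticFunction.isMultiplicative_moebius.map_mul_of_coprime
      ((hvw.coprime_dvd_left hrv).coprime_dvd_right htw),
    hvw.primeFactors_mul, Finset.prod_union hvw.disjoint_primeFactors]
  push_cast
  ring
end

section
/- For every prime p and every integer α ≥ 1, G(p^α) = (log c(p))^α · ( (1/(p+1))·(1 − 1/(p+1))^α + (p/(p+1))·(−1/(p+1))^α ). In particular, G(p) = 0. -/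
open scoped BigOperators

/-- At a prime power only the divisors `1` and `p` of the radical contribute to `GF`. -/
theorem GF_prime_pow_eq_CpF (F : Polynomial ℤ) {p α : ℕ} (hp : p.Prime) (hα : 1 ≤ α) :
    GF F (p ^ α) = 1 / ((p : ℝ) + 1) * CpF F p p ^ α +
      (p : ℝ) / ((p : ℝ) + 1) * CpF F p 1 ^ α := by
  have hpf : (p ^ α).primeFactors = {p} := Nat.primeFactors_prime_pow (by omega) hp
  rw [GF, hpf, Finset.prod_singleton, hp.sum_divisors, hp.sum_divisors]
  simp only [Finset.prod_singleton, hp.factorization_pow, Finsupp.single_eq_same,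
    Nat.divisors_one, Finset.sum_singleton, Nat.div_self hp.pos, Nat.div_one, hp.primeFactors,
    Nat.primeFactors_one, Finset.prod_empty, ArithmeticFunction.moebius_apply_one,
    ArithmeticFunction.moebius_apply_prime hp]
  push_cast
  field_simp
  ring

/-- `G(p^α) = (log c(p))^α ((1/(p+1))(1 − 1/(p+1))^α + (p/(p+1))(−1/(p+1))^α)`;
in particular `G(p) = 0`. -/
theorem GF_prime_pow (F : Polynomial ℤ) (hF : F.Monic) (hdeg : F.natDegree = 3)
    (p : ℕ) (hp : p.Prime) :
    (∀ α : ℕ, 1 ≤ α →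
      GF F (p ^ α) = (Real.log (cF F p)) ^ α *
        ((1 / ((p : ℝ) + 1)) * (1 - 1 / ((p : ℝ) + 1)) ^ α +
          ((p : ℝ) / ((p : ℝ) + 1)) * (-(1 / ((p : ℝ) + 1))) ^ α)) ∧
    GF F p = 0 := by
  have key : ∀ α : ℕ, 1 ≤ α →
      GF F (p ^ α) = (Real.log (cF F p)) ^ α *
        ((1 / ((p : ℝ) + 1)) * (1 - 1 / ((p : ℝ) + 1)) ^ α +
          ((p : ℝ) / ((p : ℝ) + 1)) * (-(1 / ((p : ℝ) + 1))) ^ α) := by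
    intro α hα
    have hsub : 1 - 1 / ((p : ℝ) + 1) = (p : ℝ) / ((p : ℝ) + 1) := by
      field_simp
      ring
    rw [GF_prime_pow_eq_CpF F hp hα, CpF, CpF, if_pos dvd_rfl,
      if_neg (by simpa using hp.one_lt.ne'), mul_pow, mul_pow, hsub]
    ring
  refine ⟨key, ?_⟩
  have h := key 1 le_rfl
  rw [pow_one] at h
  rw [h]
  field_simp
  ring
end
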